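/- Let x, y ∈ ℤ_{-τ} be consecutive (-τ)-integers with x < y (no element of ℤ_{-τ} lies strictly between x and y) and y - x = 1/τ. Then [-τ·y, -τ·x] ∩ ℤ_{-τ} = {-τ·y, -τ·x}, where -τ·x = -τ·y + 1. -/

import Mathlib

/-- The Ito–Sadahiro transformation `T_{-β}` on `[l_β, r_β)`, where
`l_β = -β/(β+1)` and `r_β = 1/(β+1)`. -/
noncomputable def negT (β : ℝ) (x : ℝ) : ℝ :=
  -β * x - (⌊-β * x - (-β / (β + 1))⌋ : ℝ)

/-- `Fin(-β)`: reals `x` such that `(-β)^k * x ∈ (l_β, r_β)` for some `k : ℤ`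
and some iterate of `T_{-β}` sends it to `0`. -/
def negFin (β : ℝ) (x : ℝ) : Prop :=
  ∃ (k : ℤ) (n : ℕ), ((-β) ^ k * x ∈ Set.Ioo (-β / (β + 1)) (1 / (β + 1))) ∧
    (negT β)^[n] ((-β) ^ k * x) = 0

/-- The set `ℤ_{-β}` of `(-β)`-integers. -/
def negInt (β : ℝ) (x : ℝ) : Prop :=
  x = 0 ∨ ∃ (N : ℕ) (y : ℝ), y ∈ Set.Ioo (-β / (β + 1)) (1 / (β + 1)) ∧
    x = (-β) ^ (N + 1) * y ∧ (negT β)^[N + 1] y = 0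

/-- The `(-β)`-digit `d_{i+1}(y)` of `y ∈ [l_β, r_β)` (indices shifted so that
`negDigit β y i` is the digit `d_{i+1}(y)`). -/
noncomputable def negDigit (β : ℝ) (y : ℝ) (i : ℕ) : ℤ :=
  ⌊-β * ((negT β)^[i] y) - (-β / (β + 1))⌋

/-- The golden ratio `τ = (1+√5)/2`. -/
noncomputable def tau : ℝ := (1 + Real.sqrt 5) / 2

/-- The Rényi transformation `T_β` on `[0,1)`. -/
noncomputable def renyiT (β : ℝ) (x : ℝ) : ℝ := β * x - (⌊β * x⌋ : ℝ)

/-- The set `ℤ_β` of (nonnegative) `β`-integers. -/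
def posInt (β : ℝ) (x : ℝ) : Prop :=
  x = 0 ∨ ∃ N : ℕ, (β ^ (-(N + 1 : ℤ)) * x ∈ Set.Ico (0 : ℝ) 1) ∧
    (renyiT β)^[N + 1] (β ^ (-(N + 1 : ℤ)) * x) = 0

theorem tau_sq : tau ^ 2 = tau + 1 := Real.goldenRatio_sq

theorem tau_irrational : Irrational tau := Real.goldenRatio_irrational

theorem tau_gt : (1.618 : ℝ) < tau := by
  have : (2.236 : ℝ) < Real.sqrt 5 := Real.lt_sqrt_of_sq_lt (by norm_num)
  unfold tau; linarith

theorem tau_lt : tau < 1.6181 := by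
  have : Real.sqrt 5 < 2.2362 := by
    rw [Real.sqrt_lt' (by norm_num)]; norm_num
  unfold tau; linarith

theorem neg_tau_div_tau_add_one : -tau / (tau + 1) = 1 - tau := by
  have h := tau_gt
  rw [div_eq_iff (by linarith)]
  linarith [tau_sq]

theorem one_div_tau_add_one : 1 / (tau + 1) = 2 - tau := by
  have h := tau_gt
  rw [div_eq_iff (by linarith)]
  linarith [tau_sq]

theorem one_div_tau : 1 / tau = tau - 1 := by
  have h := tau_gt
  rw [div_eq_iff (by linarith)]
  linarith [tau_sq]

theorem negT_tau_zero : negT tau 0 = 0 := by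
  have h : ⌊-tau * 0 - (1 - tau)⌋ = 0 := by
    rw [Int.floor_eq_zero_iff]
    constructor <;> linarith [tau_gt, tau_lt]
  rw [negT, neg_tau_div_tau_add_one, h]
  simp

/-- One step of `T_{-τ}` stays in `[l_τ, r_τ)` and uses a digit in `{0, 1}`. -/
theorem negT_tau_step {x : ℝ} (hx : x ∈ Set.Ico (1 - tau) (2 - tau)) :
    negT tau x ∈ Set.Ico (1 - tau) (2 - tau) ∧
      (negT tau x = -tau * x ∨ negT tau x = -tau * x - 1) := by
  obtain ⟨h1, h2⟩ := hx
  have ht := tau_gt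
  have hsq := tau_sq
  have hle := Int.floor_le (-tau * x - (1 - tau))
  have hlt := Int.lt_floor_add_one (-tau * x - (1 - tau))
  have hT : negT tau x = -tau * x - (⌊-tau * x - (1 - tau)⌋ : ℝ) := by
    rw [negT, neg_tau_div_tau_add_one]
  have hd0 : 0 ≤ ⌊-tau * x - (1 - tau)⌋ := by
    apply Int.floor_nonneg.mpr
    nlinarith
  have hd1 : ⌊-tau * x - (1 - tau)⌋ < 2 := by
    rw [Int.floor_lt]
    push_cast
    nlinarith [tau_lt]
  refine ⟨⟨by linarith, by linarith⟩, ?_⟩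
  rw [hT]
  generalize ⌊-tau * x - (1 - tau)⌋ = d at hd0 hd1
  interval_cases d
  · left; simp
  · right; simp

/-- `x` lies in `ℤ[τ]` and its Galois conjugate lies in `[0, τ²)`. -/
def ConjInWindow (x : ℝ) : Prop :=
  ∃ a b : ℤ, x = a + b * tau ∧
    (a + b * (1 - tau) : ℝ) ∈ Set.Ico 0 (tau + 1)

theorem ConjInWindow.neg_tau_mul_add {x : ℝ} (hx : ConjInWindow x) {d : ℤ}
    (hd : d = 0 ∨ d = 1) : ConjInWindow (-tau * x + d) := by
  obtain ⟨a, b, rfl, h0, h1⟩ := hx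
  have ht := tau_gt
  have hsq := tau_sq
  have hconj : ((-b + d : ℤ) + (-a - b : ℤ) * (1 - tau) : ℝ)
      = (tau - 1) * (a + b * (1 - tau)) + d := by
    push_cast; linear_combination (b : ℝ) * hsq
  have hnn : 0 ≤ (tau - 1) * (a + b * (1 - tau)) := mul_nonneg (by linarith) h0
  have hub : (tau - 1) * (a + b * (1 - tau)) < tau := by nlinarith
  refine ⟨-b + d, -a - b, ?_, ?_⟩
  · push_cast; linear_combination -(b : ℝ) * hsq
  · rw [hconj]
    rcases hd with rfl | rfl <;> push_cast <;> constructor <;> linarith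

theorem negT_tau_iterate_mem {y : ℝ} (hy : y ∈ Set.Ico (1 - tau) (2 - tau)) (n : ℕ) :
    (negT tau)^[n] y ∈ Set.Ico (1 - tau) (2 - tau) := by
  induction n with
  | zero => exact hy
  | succ n ih =>
    rw [Function.iterate_succ_apply']
    exact (negT_tau_step ih).1

theorem conjInWindow_pow_mul_sub_iterate {y : ℝ} (hy : y ∈ Set.Ico (1 - tau) (2 - tau))
    (n : ℕ) : ConjInWindow ((-tau) ^ n * y - (negT tau)^[n] y) := by
  induction n with
  | zero => exact ⟨0, 0, by simp, by simp, by simpa using by linarith [tau_gt]⟩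
  | succ n ih =>
    rw [Function.iterate_succ_apply']
    rcases (negT_tau_step (negT_tau_iterate_mem hy n)).2 with h | h <;> rw [h]
    · convert ih.neg_tau_mul_add (Or.inl rfl) using 1
      push_cast; ring
    · convert ih.neg_tau_mul_add (Or.inr rfl) using 1
      push_cast; ring

theorem negInt.conjInWindow {x : ℝ} (hx : negInt tau x) : ConjInWindow x := by
  rcases hx with rfl | ⟨N, y, hy, rfl, h⟩
  · exact ⟨0, 0, by simp, by simp, by simpa using by linarith [tau_gt]⟩
  · rw [neg_tau_div_tau_add_one, one_div_tau_add_one] at hy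
    simpa only [h, sub_zero] using
      conjInWindow_pow_mul_sub_iterate (Set.Ioo_subset_Ico_self hy) (N + 1)

theorem negInt.neg_tau_mul {x : ℝ} (hx : negInt tau x) : negInt tau (-tau * x) := by
  rcases hx with rfl | ⟨N, y, hy, rfl, h⟩
  · left; simp
  · refine Or.inr ⟨N + 1, y, hy, by ring, ?_⟩
    rw [Function.iterate_succ_apply', h, negT_tau_zero]

theorem eq_zero_of_add_mul_tau_eq_zero {a b : ℤ} (h : (a + b * tau : ℝ) = 0) :
    a = 0 ∧ b = 0 := by
  have hb : b = 0 := by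
    by_contra hb
    exact ((tau_irrational.intCast_mul hb).intCast_add a).ne_zero h
  subst hb
  simpa using h

/-- No `w ∈ ℤ[τ] ∩ (0, 1)` has its conjugate in `(-1/τ, τ²)`. -/
theorem no_small_element (a b : ℤ) (h : (a + b * tau : ℝ) ∈ Set.Ioo 0 1)
    (hc : (a + b * (1 - tau) : ℝ) ∈ Set.Ioo (1 - tau) (tau + 1)) : False := by
  obtain ⟨h0, h1⟩ := h
  obtain ⟨c0, c1⟩ := hc
  have ht := tau_gt
  have ht' := tau_lt
  have hb1 : b < 1 := by
    by_contra! hb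
    have : (1 : ℝ) ≤ b := by exact_mod_cast hb
    nlinarith
  have hb2 : -2 < b := by
    by_contra! hb
    have : (b : ℝ) ≤ -2 := by exact_mod_cast hb
    nlinarith
  interval_cases b
  · push_cast at h0 h1 c0 c1
    have ha : (1 : ℤ) < a := by
      have : (1 : ℝ) < a := by linarith
      exact_mod_cast this
    have ha' : a < 2 := by
      have : (a : ℝ) < 2 := by linarith
      exact_mod_cast this
    omega
  · simp only [Int.cast_zero, zero_mul, add_zero] at h0 h1
    have ha : (0 : ℤ) < a := by exact_mod_cast h0
    have ha' : a < 1 := by exact_mod_cast h1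
    omega

/-- If `x < y` are consecutive `(-τ)`-integers at distance `1/τ`, then
`[-τy, -τx] ∩ ℤ_{-τ} = {-τy, -τx}` with `-τx = -τy + 1`. -/
theorem minus_tau_image_of_gap_inv_tau
    (x y : ℝ) (hx : negInt tau x) (hy : negInt tau y) (hxy : x < y)
    (hcons : ∀ w : ℝ, negInt tau w → w ∉ Set.Ioo x y) (hgap : y - x = 1 / tau) :
    Set.Icc (-tau * y) (-tau * x) ∩ {w : ℝ | negInt tau w}
        = {-tau * y, -tau * x} ∧
      -tau * x = -tau * y + 1 := by
  have htau := tau_gt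
  have hsq := tau_sq
  rw [one_div_tau] at hgap
  have hshift : -tau * x = -tau * y + 1 := by linear_combination tau * hgap + hsq
  refine ⟨?_, hshift⟩
  ext z
  simp only [Set.mem_inter_iff, Set.mem_Icc, Set.mem_ofPred_eq, Set.mem_insert_iff,
    Set.mem_singleton_iff]
  constructor
  · rintro ⟨⟨hz1, hz2⟩, hz⟩
    by_contra! hne
    have hz1 := lt_of_le_of_ne hz1 (Ne.symm hne.1)
    have hz2 := lt_of_le_of_ne hz2 hne.2
    obtain ⟨a, b, hxab, hx0, hx1⟩ := hx.conjInWindow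
    obtain ⟨c, d, hycd, hy0, hy1⟩ := hy.conjInWindow
    obtain ⟨e, f, hzef, hz0, hz3⟩ := hz.conjInWindow
    obtain ⟨hca, hdb⟩ := eq_zero_of_add_mul_tau_eq_zero (a := c - a + 1) (b := d - b - 1)
      (by push_cast; linear_combination hgap - hycd + hxab)
    obtain rfl : a = c + 1 := by omega
    obtain rfl : b = d - 1 := by omega
    push_cast at hx0 hx1
    have hconj : (tau - 1) * (c + d * (1 - tau)) = -d - (c + d) * (1 - tau) := by
      linear_combination -(d : ℝ) * hsq
    have hnn : 0 ≤ (tau - 1) * (c + d * (1 - tau)) := mul_nonneg (by linarith) hy0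
    have hub : (tau - 1) * (c + d * (1 - tau)) < tau - 1 := by nlinarith
    have hmul : -tau * y = -d - (c + d) * tau := by
      rw [hycd]; linear_combination -(d : ℝ) * hsq
    refine no_small_element (e + d) (f + c + d) ⟨?_, ?_⟩ ⟨?_, ?_⟩ <;> push_cast <;> linarith
  · rintro (rfl | rfl)
    · exact ⟨⟨le_rfl, by linarith⟩, hy.neg_tau_mul⟩
    · exact ⟨⟨by linarith, le_rfl⟩, hx.neg_tau_mul⟩
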